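/- arXiv:1303.0969 — 4 statements merged into one kernel-verified Lean document; each statement's English description precedes it below -/
import Mathlib

section
/- Let α, ρ ∈ (0,1) with α irrational. Then R'^α_ρ = E(R^{1−α}_{1−ρ}), where E : {0,1}* → {0,1}* is the morphism interchanging the letters 0 and 1 (applied elementwise to the set of words). -/
open Set

noncomputable section

/-- Exchange of two intervals with parameter `α`, acting on `[0,1)`:
`T_α(x) = x + 1 - α` for `x ∈ [0,α)` and `T_α(x) = x - α` for `x ∈ [α,1)`. -/
def twoIE (α x : ℝ) : ℝ := if x < α then x + 1 - α else x - α

/-- The Sturmian word with slope `α` and intercept `ρ`: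
`false` codes the letter 0 (i.e. `T_α^n(ρ) ∈ [0,α)`), `true` codes the letter 1. -/
def sturmian (α ρ : ℝ) (n : ℕ) : Bool := if α ≤ (twoIE α)^[n] ρ then true else false

/-- The factor of length `n` of an infinite word `u` starting at position `i`. -/
def seg (u : ℕ → Bool) (i n : ℕ) : List Bool := (List.range n).map (fun j => u (i + j))

/-- The prefix of length `n` of `u`. -/
def wordPrefix (u : ℕ → Bool) (n : ℕ) : List Bool := seg u 0 n

/-- Return time of `x` to the set `I` under `twoIE α`:
the least `m ≥ 1` such that `T_α^m(x) ∈ I`. -/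
def returnTime (α : ℝ) (I : Set ℝ) (x : ℝ) : ℕ :=
  sInf {m : ℕ | 0 < m ∧ (twoIE α)^[m] x ∈ I}

/-- The `I`-itinerary of `x`: the prefix of length `returnTime α I x` of the
Sturmian word with slope `α` and intercept `x`. -/
def itin (α : ℝ) (I : Set ℝ) (x : ℝ) : List Bool :=
  wordPrefix (sturmian α x) (returnTime α I x)

/-- Two binary words are abelian equivalent if they have the same length and the
same number of occurrences of the letter 0 (coded by `false`). -/
def AbEquiv (w w' : List Bool) : Prop :=
  w.length = w'.length ∧ w.count false = w'.count false

/-- `w` is a factor of the infinite word `u`. -/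
def IsFactor (u : ℕ → Bool) (w : List Bool) : Prop := ∃ i, seg u i w.length = w

/-- Positions of occurrences in `u` of factors abelian equivalent to `w`. -/
def abOcc (u : ℕ → Bool) (w : List Bool) : Set ℕ :=
  {i | AbEquiv (seg u i w.length) w}

/-- The set of abelian return words to `w` in `u`: the words of `u` lying between
two consecutive occurrences of factors abelian equivalent to `w`. -/
def AR (u : ℕ → Bool) (w : List Bool) : Set (List Bool) :=
  {v | ∃ i j : ℕ, i ∈ abOcc u w ∧ j ∈ abOcc u w ∧ i < j ∧
        (∀ m, i < m → m < j → m ∉ abOcc u w) ∧ v = seg u i (j - i)}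

/-- The set of abelian return words to all nonempty prefixes of `u`. -/
def APR (u : ℕ → Bool) : Set (List Bool) :=
  ⋃ n ∈ {n : ℕ | 1 ≤ n}, AR u (wordPrefix u n)

/-- `S_β`: the set of `[0,β)`-itineraries under `twoIE α`. -/
def Sitin (α β : ℝ) : Set (List Bool) :=
  {w | ∃ x ∈ Ico (0:ℝ) β, itin α (Ico (0:ℝ) β) x = w}

/-- `R^α_ρ`: the union of the sets of `[0,β)`-itineraries over `ρ ≤ β < 1`. -/
def Rlight (α ρ : ℝ) : Set (List Bool) := ⋃ β ∈ Ico ρ 1, Sitin α β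

/-- `R'^α_ρ`: the union of the sets of `[γ,1)`-itineraries over `0 < γ ≤ ρ`. -/
def Rheavy (α ρ : ℝ) : Set (List Bool) :=
  ⋃ γ ∈ Ioc (0:ℝ) ρ, {w | ∃ x ∈ Ico γ 1, itin α (Ico γ 1) x = w}

/-- The Gauss map `x ↦ {1/x}`. -/
def gaussMap (x : ℝ) : ℝ := Int.fract x⁻¹

/-- The `k`-th partial quotient `a_k` (for `k ≥ 1`) of the continued fraction
expansion `α = [0; a_1, a_2, …]` of `α ∈ (0,1)`. -/
def cfa (α : ℝ) (k : ℕ) : ℕ := ⌊(gaussMap^[k - 1] α)⁻¹⌋₊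

/-- `cfPQ α n = (p_{n-1}, q_{n-1})`, numerators and denominators of the convergents
of `α`: `p_{-1} = 1`, `q_{-1} = 0`, `p_0 = 0`, `q_0 = 1`,
`p_k = a_k p_{k-1} + p_{k-2}`, `q_k = a_k q_{k-1} + q_{k-2}`. -/
def cfPQ (α : ℝ) : ℕ → ℤ × ℤ
  | 0 => (1, 0)
  | 1 => (0, 1)
  | (k + 2) => ((cfa α (k + 1) : ℤ) * (cfPQ α (k + 1)).1 + (cfPQ α k).1,
                (cfa α (k + 1) : ℤ) * (cfPQ α (k + 1)).2 + (cfPQ α k).2)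

/-- `δ_{k,s} = |(s-1)(p_k - α q_k) + p_{k-1} - α q_{k-1}|` for `k ≥ 0`, `1 ≤ s ≤ a_{k+1}`. -/
def cfDelta (α : ℝ) (k s : ℕ) : ℝ :=
  |((s : ℝ) - 1) * (((cfPQ α (k + 1)).1 : ℝ) - α * ((cfPQ α (k + 1)).2 : ℝ)) +
      (((cfPQ α k).1 : ℝ) - α * ((cfPQ α k).2 : ℝ))|

end
theorem twoIE_mem_Ico {α x : ℝ} (hα : α ∈ Ioo (0 : ℝ) 1) (hx : x ∈ Ico (0 : ℝ) 1) :
    twoIE α x ∈ Ico (0 : ℝ) 1 := by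
  obtain ⟨h0, h1⟩ := hα
  obtain ⟨h2, h3⟩ := hx
  unfold twoIE
  split_ifs with h
  · constructor <;> linarith
  · constructor <;> linarith

theorem iterate_twoIE_mem_Ico {α x : ℝ} (hα : α ∈ Ioo (0 : ℝ) 1) (hx : x ∈ Ico (0 : ℝ) 1)
    (n : ℕ) : (twoIE α)^[n] x ∈ Ico (0 : ℝ) 1 := by
  induction n with
  | zero => exact hx
  | succ n ih =>
    rw [Function.iterate_succ_apply']
    exact twoIE_mem_Ico hα ih

theorem coe_iterate_twoIE (α x : ℝ) (n : ℕ) :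
    (((twoIE α)^[n] x : ℝ) : AddCircle (1 : ℝ)) =
      (x : AddCircle (1 : ℝ)) - n • (α : AddCircle (1 : ℝ)) := by
  have hT (t : ℝ) : ((twoIE α t : ℝ) : AddCircle (1 : ℝ)) =
      (t : AddCircle (1 : ℝ)) - (α : AddCircle (1 : ℝ)) := by
    unfold twoIE
    split_ifs
    · rw [AddCircle.coe_sub, AddCircle.coe_add, AddCircle.coe_period, add_zero]
    · rw [AddCircle.coe_sub]
  induction n with
  | zero => simp
  | succ n ih =>
    rw [Function.iterate_succ_apply', hT, ih, succ_nsmul, sub_sub]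

/-- Every forward orbit of the exchange of two intervals with irrational parameter visits every
nonempty interval `[a,b) ⊆ [0,1)` at a positive time. -/
theorem exists_pos_iterate_twoIE_mem {α a b x : ℝ} (hα : α ∈ Ioo (0 : ℝ) 1)
    (hirr : Irrational α) (ha : 0 ≤ a) (hab : a < b) (hb : b ≤ 1) (hx : x ∈ Ico (0 : ℝ) 1) :
    ∃ m, 0 < m ∧ (twoIE α)^[m] x ∈ Ico a b := by
  have hd : DenseRange (fun n : ℕ => n • (α : AddCircle (1 : ℝ))) := by
    rw [← denseRange_zsmul_iff_nsmul]
    exact AddCircle.denseRange_zsmul_coe_iff.2 (by simpa using hirr)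
  have hopen : IsOpen ((fun t : ℝ => (t : AddCircle (1 : ℝ))) '' Ioo (x - α - b) (x - α - a)) :=
    QuotientAddGroup.isOpenMap_coe _ isOpen_Ioo
  obtain ⟨n, w, ⟨hw1, hw2⟩, hw⟩ :=
    hd.exists_mem_open hopen ((nonempty_Ioo.2 (by linarith)).image _)
  refine ⟨n + 1, n.succ_pos, ?_⟩
  have hcoe : (((twoIE α)^[n + 1] x : ℝ) : AddCircle (1 : ℝ)) =
      ((x - α - w : ℝ) : AddCircle (1 : ℝ)) := by
    rw [coe_iterate_twoIE, succ_nsmul, AddCircle.coe_sub, AddCircle.coe_sub,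
      show (w : AddCircle (1 : ℝ)) = n • (α : AddCircle (1 : ℝ)) from hw]
    abel
  have heq : (twoIE α)^[n + 1] x = x - α - w := by
    have : Fact ((0 : ℝ) < 1) := ⟨one_pos⟩
    refine (AddCircle.coe_eq_coe_iff_of_mem_Ico (p := (1 : ℝ)) (a := 0) ?_ ?_).1 hcoe
    · simpa using iterate_twoIE_mem_Ico hα hx (n + 1)
    · constructor <;> linarith
  rw [heq]
  constructor <;> linarith

/-- A small shift to the right followed by the reflection `t ↦ 1 - t` turns `[a,b)`-itineraries
for `α` into letter-exchanged `[1-b,1-a)`-itineraries for `1 - α`. -/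
theorem exists_itin_one_sub_eq {α a b x : ℝ} (hα : α ∈ Ioo (0 : ℝ) 1)
    (hirr : Irrational α) (ha : 0 ≤ a) (hb : b ≤ 1) (hx : x ∈ Ico a b) :
    ∃ y ∈ Ico (1 - b) (1 - a),
      itin (1 - α) (Ico (1 - b) (1 - a)) y = (itin α (Ico a b) x).map (fun c => !c) := by
  have hne : {m : ℕ | 0 < m ∧ (twoIE α)^[m] x ∈ Ico a b}.Nonempty :=
    exists_pos_iterate_twoIE_mem hα hirr ha (hx.1.trans_lt hx.2) hb
      ⟨ha.trans hx.1, hx.2.trans_le hb⟩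
  set r := returnTime α (Ico a b) x with hr
  have hrmem : 0 < r ∧ (twoIE α)^[r] x ∈ Ico a b := Nat.sInf_mem hne
  have hrmin (m : ℕ) (hm : 0 < m) (hmI : (twoIE α)^[m] x ∈ Ico a b) : r ≤ m :=
    Nat.sInf_le ⟨hm, hmI⟩
  have hshift (t c : ℝ) : ∀ᶠ ε in nhdsWithin (0 : ℝ) (Ioi 0), t < c → t + ε < c := by
    by_cases h : t < c
    · filter_upwards [Ioo_mem_nhdsGT (sub_pos.2 h)] with ε hε _
      linarith [hε.2]
    · exact Filter.Eventually.of_forall fun _ h' => absurd h' h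
  have hall : ∀ᶠ ε in nhdsWithin (0 : ℝ) (Ioi 0), ∀ i ∈ Finset.range (r + 1),
      ((twoIE α)^[i] x < a → (twoIE α)^[i] x + ε < a) ∧
      ((twoIE α)^[i] x < b → (twoIE α)^[i] x + ε < b) ∧
      ((twoIE α)^[i] x < α → (twoIE α)^[i] x + ε < α) :=
    (Finset.eventually_all _).2 fun _ _ => (hshift _ _).and ((hshift _ _).and (hshift _ _))
  obtain ⟨ε, hε, (hε0 : 0 < ε)⟩ := (hall.and self_mem_nhdsWithin).exists
  replace hε (i : ℕ) (hi : i ≤ r) := hε i (Finset.mem_range.2 (Nat.lt_succ_of_le hi))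
  have horb (i : ℕ) (hi : i ≤ r) :
      (twoIE (1 - α))^[i] (1 - (x + ε)) = 1 - ((twoIE α)^[i] x + ε) := by
    induction i with
    | zero => rfl
    | succ i ih =>
      rw [Function.iterate_succ_apply', Function.iterate_succ_apply', ih (by omega)]
      have h := (hε i (by omega)).2.2
      generalize (twoIE α)^[i] x = t at h
      unfold twoIE
      by_cases ht : t < α
      · rw [if_pos ht, if_neg (by linarith [h ht])]
        ring
      · rw [if_neg ht, if_pos (by linarith)]
        ring
  have hmem (i : ℕ) (hi : i ≤ r) :
      (twoIE (1 - α))^[i] (1 - (x + ε)) ∈ Ico (1 - b) (1 - a) ↔ (twoIE α)^[i] x ∈ Ico a b := by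
    rw [horb i hi]
    obtain ⟨h1, h2, -⟩ := hε i hi
    generalize (twoIE α)^[i] x = t at h1 h2
    constructor
    · rintro ⟨h3, h4⟩
      constructor
      · by_contra! h
        linarith [h1 h]
      · linarith
    · rintro ⟨h3, h4⟩
      constructor <;> linarith [h2 h4]
  have hret : returnTime (1 - α) (Ico (1 - b) (1 - a)) (1 - (x + ε)) = r := by
    have hr' := (hmem r le_rfl).2 hrmem.2
    refine le_antisymm (Nat.sInf_le ⟨hrmem.1, hr'⟩) (le_csInf ⟨r, hrmem.1, hr'⟩ ?_)
    rintro m ⟨hm, hmI⟩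
    by_contra! hlt
    exact hlt.not_ge (hrmin m hm ((hmem m hlt.le).1 hmI))
  refine ⟨1 - (x + ε), (hmem 0 (Nat.zero_le _)).2 hx, ?_⟩
  unfold itin
  rw [hret, ← hr]
  unfold wordPrefix seg
  rw [List.map_map]
  refine List.map_congr_left fun i hi => ?_
  have hi' : i ≤ r := (List.mem_range.1 hi).le
  simp only [Function.comp_apply, zero_add, sturmian]
  rw [horb i hi']
  have h := (hε i hi').2.2
  generalize (twoIE α)^[i] x = t at h
  by_cases ht : t < α
  · rw [if_pos (by linarith [h ht]), if_neg (not_le.2 ht)]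
    rfl
  · rw [if_neg (by linarith), if_pos (not_lt.1 ht)]
    rfl

/-- `R'^α_ρ = E(R^{1-α}_{1-ρ})`, where `E` interchanges the letters. -/
theorem Rheavy_eq_image_Rlight (α ρ : ℝ) (hα : α ∈ Set.Ioo (0:ℝ) 1)
    (hirr : Irrational α) (hρ : ρ ∈ Set.Ioo (0:ℝ) 1) :
    Rheavy α ρ =
      (fun w : List Bool => w.map (fun b => !b)) '' Rlight (1 - α) (1 - ρ) := by
  ext w
  simp only [Rheavy, Rlight, Sitin, mem_iUnion, mem_image, mem_ofPred_eq, exists_prop]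
  constructor
  · rintro ⟨γ, ⟨hγ0, hγρ⟩, x, hx, rfl⟩
    obtain ⟨y, hy, hyw⟩ := exists_itin_one_sub_eq hα hirr hγ0.le le_rfl hx
    rw [sub_self] at hy hyw
    refine ⟨_, ⟨1 - γ, ⟨by linarith, by linarith⟩, y, hy, rfl⟩, ?_⟩
    rw [hyw, List.map_map]
    simp [Function.comp_def]
  · rintro ⟨_, ⟨β, ⟨hβρ, hβ1⟩, x, hx, rfl⟩, rfl⟩
    have hα' : 1 - α ∈ Ioo (0 : ℝ) 1 := ⟨by linarith [hα.2], by linarith [hα.1]⟩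
    have hirr' : Irrational (1 - α) := by simpa using hirr.ratCast_sub 1
    obtain ⟨y, hy, hyw⟩ := exists_itin_one_sub_eq hα' hirr' le_rfl hβ1.le hx
    rw [sub_zero] at hy hyw
    rw [sub_sub_cancel] at hyw
    exact ⟨1 - β, ⟨by linarith, by linarith⟩, y, hy, hyw⟩
end

section
/- Let α, ρ ∈ (0,1) with α = [0; a_1, a_2, a_3, …] irrational. Let k ≥ 0 and 1 ≤ s ≤ a_{k+1} be the lexicographically minimal pair (k,s) such that ρ ≥ δ_{k,s}. Then the cardinality of R^α_ρ equals 1 + a_1 + a_2 + ⋯ + a_k + s. -/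
open Set

/-! ### Iterates of the interval exchange and return times -/

lemma twoIE_iterate_eq_fract {α x : ℝ} (hα : α ∈ Ioo (0 : ℝ) 1) (hx : x ∈ Ico (0 : ℝ) 1) (n : ℕ) :
    (twoIE α)^[n] x = Int.fract (x - n * α) := by
  obtain ⟨hα0, hα1⟩ := hα
  induction n with
  | zero => simpa using (Int.fract_eq_self.2 hx).symm
  | succ n ih =>
    rw [Function.iterate_succ_apply', ih, twoIE]
    have h0 := Int.fract_nonneg (x - n * α)
    have h1 := Int.fract_lt_one (x - n * α)
    have h2 := Int.floor_add_fract (x - n * α)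
    symm
    split_ifs with h
    · rw [Int.fract_eq_iff]
      refine ⟨by linarith, by linarith, ⌊x - n * α⌋ - 1, ?_⟩
      push_cast
      linarith
    · rw [Int.fract_eq_iff]
      refine ⟨by linarith, by linarith, ⌊x - n * α⌋, ?_⟩
      push_cast
      linarith

lemma twoIE_iterate_mem_Ico_iff {α x β : ℝ} (hα : α ∈ Ioo (0 : ℝ) 1) (hx : x ∈ Ico (0 : ℝ) 1)
    (hβ : β ≤ 1) (n : ℕ) :
    (twoIE α)^[n] x ∈ Ico 0 β ↔ ∃ c : ℤ, 0 ≤ x + (c - n * α) ∧ x + (c - n * α) < β := by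
  rw [twoIE_iterate_eq_fract hα hx]
  have h2 := Int.floor_add_fract (x - n * α)
  constructor
  · rintro ⟨h0, h1⟩
    refine ⟨-⌊x - n * α⌋, ?_, ?_⟩ <;> push_cast <;> linarith
  · rintro ⟨c, h0, h1⟩
    have h : Int.fract (x - n * α) = x + (c - n * α) := by
      rw [Int.fract_eq_iff]
      exact ⟨h0, by linarith, -c, by push_cast; ring⟩
    rw [h]
    exact ⟨h0, h1⟩

lemma returnTime_eq {α β x : ℝ} {n : ℕ} (hα : α ∈ Ioo (0 : ℝ) 1) (hβ : β ≤ 1)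
    (hx : x ∈ Ico (0 : ℝ) β) (hn : 0 < n) {c : ℤ} (h0 : 0 ≤ x + (c - n * α))
    (h1 : x + (c - n * α) < β)
    (hlt : ∀ m : ℕ, 0 < m → m < n → ∀ c : ℤ, 0 ≤ x + (c - m * α) → β ≤ x + (c - m * α)) :
    returnTime α (Ico 0 β) x = n := by
  have hx1 : x ∈ Ico (0 : ℝ) 1 := ⟨hx.1, hx.2.trans_le hβ⟩
  refine IsLeast.csInf_eq ⟨⟨hn, (twoIE_iterate_mem_Ico_iff hα hx1 hβ n).2 ⟨c, h0, h1⟩⟩, ?_⟩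
  rintro m ⟨hm, hmem⟩
  obtain ⟨c', h0', h1'⟩ := (twoIE_iterate_mem_Ico_iff hα hx1 hβ m).1 hmem
  by_contra! hmn
  exact absurd (hlt m hm hmn c' h0') (not_le.2 h1')

lemma not_return_before {α β x : ℝ} {m : ℕ} (hα : α ∈ Ioo (0 : ℝ) 1) (hβ : β ≤ 1)
    (hx : x ∈ Ico (0 : ℝ) β) (hm : 0 < m) (hlt : m < returnTime α (Ico 0 β) x) (c : ℤ)
    (h0 : 0 ≤ x + (c - m * α)) : β ≤ x + (c - m * α) := by
  by_contra! h1
  exact Nat.notMem_of_lt_sInf hlt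
    ⟨hm, (twoIE_iterate_mem_Ico_iff hα ⟨hx.1, hx.2.trans_le hβ⟩ hβ m).2 ⟨c, h0, h1⟩⟩

lemma exists_return {α β x : ℝ} (hα : α ∈ Ioo (0 : ℝ) 1) (hβ : β ≤ 1)
    (hx : x ∈ Ico (0 : ℝ) β) (hpos : 0 < returnTime α (Ico 0 β) x) :
    ∃ c : ℤ, 0 ≤ x + (c - (returnTime α (Ico 0 β) x : ℕ) * α) ∧
      x + (c - (returnTime α (Ico 0 β) x : ℕ) * α) < β :=
  (twoIE_iterate_mem_Ico_iff hα ⟨hx.1, hx.2.trans_le hβ⟩ hβ _).1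
    (Nat.sInf_mem (Nat.nonempty_of_pos_sInf hpos)).2

/-! ### Itineraries are determined by their length -/

lemma length_itin (α : ℝ) (I : Set ℝ) (x : ℝ) : (itin α I x).length = returnTime α I x := by
  simp [itin, wordPrefix, seg]

lemma le_fract_iff_floor_le (α x : ℝ) (n : ℕ) :
    α ≤ Int.fract (x - n * α) ↔ ⌊x - n * α⌋ ≤ ⌊x - (n + 1 : ℕ) * α⌋ := by
  have h2 := Int.floor_add_fract (x - n * α)
  rw [Int.le_floor]
  push_cast
  constructor <;> intro h <;> linarith

lemma floor_eq_of_returnTime_eq {α β β' x x' : ℝ} {n : ℕ} (hα : α ∈ Ioo (0 : ℝ) 1)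
    (hβ : β ≤ 1) (hβ' : β' ≤ 1) (hx : x ∈ Ico (0 : ℝ) β) (hx' : x' ∈ Ico (0 : ℝ) β') (hn : 2 ≤ n)
    (h : returnTime α (Ico 0 β) x = n) (h' : returnTime α (Ico 0 β') x' = n) (hle : x ≤ x')
    {i : ℕ} (hi : i ≤ n) : ⌊x - i * α⌋ = ⌊x' - i * α⌋ := by
  by_contra hne
  have hlt : ⌊x - i * α⌋ < ⌊x' - i * α⌋ :=
    lt_of_le_of_ne (Int.floor_le_floor (by linarith)) hne
  obtain ⟨c, hc⟩ : ∃ c, c = ⌊x' - i * α⌋ := ⟨_, rfl⟩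
  rw [← hc] at hlt
  have hxc : x - i * α < c := Int.floor_lt.1 hlt
  have hxc' : (c : ℝ) ≤ x' - i * α := hc ▸ Int.floor_le _
  obtain ⟨hx0, hxβ⟩ := hx
  obtain ⟨hx0', hxβ'⟩ := hx'
  have hi0 : 0 < i := by
    rcases Nat.eq_zero_or_pos i with rfl | hpos
    · simp only [Nat.cast_zero, zero_mul, sub_zero] at hxc hxc'
      have h1 : (c : ℝ) < 1 := by linarith
      have h2 : (0 : ℝ) < c := by linarith
      norm_cast at h1 h2
      omega
    · exact hpos
  have hin : i = n := by
    by_contra hin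
    have := not_return_before hα hβ' ⟨hx0', hxβ'⟩ hi0 (h' ▸ lt_of_le_of_ne hi hin) (-c)
      (by push_cast; linarith)
    push_cast at this
    linarith
  subst hin
  obtain ⟨b, hb0, hb1⟩ := exists_return hα hβ ⟨hx0, hxβ⟩ (by omega)
  rw [h] at hb0 hb1
  have hb : -c + 1 ≤ b := by
    have : (-c : ℝ) < b := by linarith
    have : -c < b := by exact_mod_cast this
    omega
  have hb' : (-c : ℝ) + 1 ≤ b := by exact_mod_cast hb
  have hxα' : x' < α := by
    by_contra! hge
    have := not_return_before hα hβ' ⟨hx0', hxβ'⟩ one_pos (by omega) 0 (by push_cast; linarith)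
    push_cast at this
    linarith [hα.1]
  obtain ⟨j, rfl⟩ : ∃ j, i = j + 1 := ⟨i - 1, by omega⟩
  push_cast at *
  have := not_return_before hα hβ ⟨hx0, hxβ⟩ (m := j) (by omega) (by omega) (-c)
    (by push_cast; linarith)
  push_cast at this
  linarith [hα.2]

lemma itin_eq_of_returnTime_eq {α β β' x x' : ℝ} {n : ℕ} (hα : α ∈ Ioo (0 : ℝ) 1)
    (hβ : β ≤ 1) (hβ' : β' ≤ 1) (hx : x ∈ Ico (0 : ℝ) β) (hx' : x' ∈ Ico (0 : ℝ) β') (hn : 2 ≤ n)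
    (h : returnTime α (Ico 0 β) x = n) (h' : returnTime α (Ico 0 β') x' = n) :
    itin α (Ico 0 β) x = itin α (Ico 0 β') x' := by
  have hfloor : ∀ i ≤ n, ⌊x - i * α⌋ = ⌊x' - i * α⌋ := fun i hi ↦ by
    rcases le_total x x' with hle | hle
    · exact floor_eq_of_returnTime_eq hα hβ hβ' hx hx' hn h h' hle hi
    · exact (floor_eq_of_returnTime_eq hα hβ' hβ hx' hx hn h' h hle hi).symm
  rw [itin, itin, h, h', wordPrefix, wordPrefix, seg, seg]
  refine List.map_congr_left fun i hi ↦ ?_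
  rw [List.mem_range] at hi
  simp only [sturmian, zero_add, twoIE_iterate_eq_fract hα ⟨hx.1, hx.2.trans_le hβ⟩,
    twoIE_iterate_eq_fract hα ⟨hx'.1, hx'.2.trans_le hβ'⟩, le_fract_iff_floor_le,
    hfloor i hi.le, hfloor (i + 1) hi]

/-! ### Return times to `[0,β)` via the subtractive Euclidean algorithm -/

/-- Candidate return data for an interval `[0,β)`: rotating `right` times moves a point to the right
by `rightGap`, rotating `left` times moves it to the left by `leftGap`. -/
@[ext]
structure GapState where
  right : ℕ
  left : ℕ
  rightGap : ℝ
  leftGap : ℝ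

/-- One step of the subtractive Euclidean algorithm. -/
noncomputable def GapState.next (S : GapState) : GapState :=
  if S.leftGap < S.rightGap then
    ⟨S.right + S.left, S.left, S.rightGap - S.leftGap, S.leftGap⟩
  else ⟨S.right, S.right + S.left, S.rightGap, S.leftGap - S.rightGap⟩

/-- The states of the subtractive Euclidean algorithm started from `1 - α` and `α`. -/
noncomputable def gapState (α : ℝ) (i : ℕ) : GapState := GapState.next^[i] ⟨1, 1, 1 - α, α⟩

/-- The largest length of an interval whose return times are described by the state. -/
def GapState.total (S : GapState) : ℝ := S.rightGap + S.leftGap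

/-- The largest return time described by the state. -/
def GapState.time (S : GapState) : ℕ := S.right + S.left

/-- The gaps are realised by rotations by multiples of `α`, and no smaller number of rotations moves
a point by less than the total gap in the respective direction. -/
structure GapState.Valid (α : ℝ) (S : GapState) : Prop where
  right_pos : 0 < S.right
  left_pos : 0 < S.left
  rightGap_pos : 0 < S.rightGap
  leftGap_pos : 0 < S.leftGap
  total_le : S.total ≤ 1
  rightGap_eq : ∃ c : ℤ, S.rightGap = c - S.right * α
  leftGap_eq : ∃ c : ℤ, S.leftGap = -(c - S.left * α)
  le_right : ∀ m : ℕ, 0 < m → m < S.right → ∀ c : ℤ, 0 < c - m * α → S.total ≤ c - m * α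
  le_left : ∀ m : ℕ, 0 < m → m < S.left → ∀ c : ℤ, c - m * α < 0 → S.total ≤ -(c - m * α)

lemma int_sub_mul_ne_zero {α : ℝ} (hirr : Irrational α) {m : ℕ} (hm : 0 < m) (c : ℤ) :
    (c : ℝ) - m * α ≠ 0 := by
  intro h
  exact (hirr.natCast_mul hm.ne').ne_int c (by linarith)

namespace GapState

variable {α : ℝ} {S : GapState}

lemma next_of_lt (h : S.leftGap < S.rightGap) :
    S.next = ⟨S.right + S.left, S.left, S.rightGap - S.leftGap, S.leftGap⟩ := if_pos h

lemma next_of_not_lt (h : ¬ S.leftGap < S.rightGap) :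
    S.next = ⟨S.right, S.right + S.left, S.rightGap, S.leftGap - S.rightGap⟩ := if_neg h

lemma total_next : S.next.total = max S.rightGap S.leftGap := by
  by_cases h : S.leftGap < S.rightGap
  · simp [next_of_lt h, total, max_eq_left h.le]
  · simp [next_of_not_lt h, total, max_eq_right (not_lt.1 h)]

namespace Valid

lemma rightGap_ne_leftGap (hS : S.Valid α) (hirr : Irrational α) : S.rightGap ≠ S.leftGap := by
  obtain ⟨a, ha⟩ := hS.rightGap_eq
  obtain ⟨b, hb⟩ := hS.leftGap_eq
  intro h
  apply int_sub_mul_ne_zero hirr (Nat.add_pos_left hS.right_pos S.left) (a + b)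
  push_cast
  linarith

lemma rightGap_le (hS : S.Valid α) {m : ℕ} (hm : 0 < m) (hlt : m < S.time)
    {c : ℤ} (hc : 0 < c - m * α) : S.rightGap ≤ c - m * α := by
  have hl := hS.leftGap_pos
  have htot := hS.total_le
  have hR := hS.le_right m hm
  unfold total at *
  rcases lt_trichotomy m S.right with h | rfl | h
  · linarith [hR h c hc]
  · obtain ⟨a, ha⟩ := hS.rightGap_eq
    have hac : a ≤ c := by
      by_contra! hac
      have : (c : ℝ) + 1 ≤ a := by exact_mod_cast hac
      linarith
    have : (a : ℝ) ≤ c := by exact_mod_cast hac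
    linarith
  · obtain ⟨a, ha⟩ := hS.rightGap_eq
    obtain ⟨j, rfl⟩ := Nat.exists_eq_add_of_lt h
    have hL := hS.le_left (j + 1) (by omega) (by unfold time at hlt; omega) (c - a)
    unfold total at hL
    push_cast at *
    by_contra! hcon
    linarith [hL (by linarith)]

lemma leftGap_le (hS : S.Valid α) {m : ℕ} (hm : 0 < m) (hlt : m < S.time)
    {c : ℤ} (hc : c - m * α < 0) : S.leftGap ≤ -(c - m * α) := by
  have hl := hS.rightGap_pos
  have htot := hS.total_le
  have hL := hS.le_left m hm
  unfold total at *
  rcases lt_trichotomy m S.left with h | rfl | h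
  · linarith [hL h c hc]
  · obtain ⟨a, ha⟩ := hS.leftGap_eq
    have hac : c ≤ a := by
      by_contra! hac
      have : (a : ℝ) + 1 ≤ c := by exact_mod_cast hac
      linarith
    have : (c : ℝ) ≤ a := by exact_mod_cast hac
    linarith
  · obtain ⟨a, ha⟩ := hS.leftGap_eq
    obtain ⟨j, rfl⟩ := Nat.exists_eq_add_of_lt h
    have hR := hS.le_right (j + 1) (by omega) (by unfold time at hlt; omega) (c - a)
    unfold total at hR
    push_cast at *
    by_contra! hcon
    linarith [hR (by linarith)]

lemma next (hS : S.Valid α) (hirr : Irrational α) : S.next.Valid α := by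
  have hr := hS.rightGap_pos
  have hl := hS.leftGap_pos
  have htot := hS.total_le
  have hne := hS.rightGap_ne_leftGap hirr
  obtain ⟨a, ha⟩ := hS.rightGap_eq
  obtain ⟨b, hb⟩ := hS.leftGap_eq
  unfold total at htot
  by_cases h : S.leftGap < S.rightGap
  · rw [next_of_lt h]
    refine ⟨Nat.add_pos_left hS.right_pos _, hS.left_pos, sub_pos.2 h, hl, ?_, ⟨a + b, ?_⟩, ⟨b, hb⟩,
      fun m hm hlt c hc ↦ ?_, fun m hm hlt c hc ↦ ?_⟩
    · simp only [total]; linarith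
    · push_cast; linarith
    · simpa [total] using hS.rightGap_le hm hlt hc
    · have := hS.le_left m hm hlt c hc
      simp only [total] at *
      linarith
  · have h' : S.rightGap < S.leftGap := lt_of_le_of_ne (not_lt.1 h) hne
    rw [next_of_not_lt h]
    refine ⟨hS.right_pos, Nat.add_pos_left hS.right_pos _, hr, sub_pos.2 h', ?_, ⟨a, ha⟩,
      ⟨a + b, ?_⟩, fun m hm hlt c hc ↦ ?_, fun m hm hlt c hc ↦ ?_⟩
    · simp only [total]; linarith
    · push_cast; linarith
    · have := hS.le_right m hm hlt c hc
      simp only [total] at *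
      linarith
    · simpa [total] using hS.leftGap_le hm hlt hc

variable {β x : ℝ}

lemma returnTime_right (hS : S.Valid α) (hα : α ∈ Ioo (0 : ℝ) 1) (hirr : Irrational α)
    (hβ : β ≤ S.total) (hx : 0 ≤ x) (hxβ : x + S.rightGap < β) :
    returnTime α (Ico 0 β) x = S.right := by
  have hr := hS.rightGap_pos
  obtain ⟨a, ha⟩ := hS.rightGap_eq
  refine returnTime_eq hα (hβ.trans hS.total_le) ⟨hx, by linarith⟩ hS.right_pos (c := a)
    (by linarith) (by linarith) fun m hm hlt c hc ↦ ?_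
  rcases (int_sub_mul_ne_zero hirr hm c).lt_or_gt with h | h
  · have := hS.leftGap_le hm (by unfold time; omega) h
    unfold total at hβ
    linarith
  · linarith [hS.le_right m hm hlt c h]

lemma returnTime_left (hS : S.Valid α) (hα : α ∈ Ioo (0 : ℝ) 1) (hirr : Irrational α)
    (hβ : β ≤ S.total) (hx : S.leftGap ≤ x) (hxβ : x < β) :
    returnTime α (Ico 0 β) x = S.left := by
  have hl := hS.leftGap_pos
  obtain ⟨a, ha⟩ := hS.leftGap_eq
  refine returnTime_eq hα (hβ.trans hS.total_le) ⟨by linarith, hxβ⟩ hS.left_pos (c := a)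
    (by linarith) (by linarith) fun m hm hlt c hc ↦ ?_
  rcases (int_sub_mul_ne_zero hirr hm c).lt_or_gt with h | h
  · linarith [hS.le_left m hm hlt c h]
  · have := hS.rightGap_le hm (by unfold time; omega) h
    unfold total at hβ
    linarith

lemma returnTime_middle (hS : S.Valid α) (hα : α ∈ Ioo (0 : ℝ) 1) (hirr : Irrational α)
    (hβ : β ≤ S.total) (hrβ : S.rightGap < β) (hlβ : S.leftGap < β)
    (hx : β ≤ x + S.rightGap) (hxl : x < S.leftGap) :
    returnTime α (Ico 0 β) x = S.time := by
  obtain ⟨a, ha⟩ := hS.rightGap_eq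
  obtain ⟨b, hb⟩ := hS.leftGap_eq
  refine returnTime_eq hα (hβ.trans hS.total_le) ⟨by linarith, by linarith⟩
    (Nat.add_pos_left hS.right_pos _) (c := a + b)
    (by unfold time; push_cast; linarith) (by unfold time; push_cast; linarith)
    fun m hm hlt c hc ↦ ?_
  rcases (int_sub_mul_ne_zero hirr hm c).lt_or_gt with h | h
  · linarith [hS.leftGap_le hm hlt h]
  · linarith [hS.rightGap_le hm hlt h]

end Valid

end GapState

section GapState

variable {α : ℝ}

lemma gapState_succ (α : ℝ) (i : ℕ) : gapState α (i + 1) = (gapState α i).next :=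
  Function.iterate_succ_apply' _ _ _

lemma gapState_valid (hα : α ∈ Ioo (0 : ℝ) 1) (hirr : Irrational α) (i : ℕ) :
    (gapState α i).Valid α := by
  induction i with
  | zero =>
    refine ⟨one_pos, one_pos, sub_pos.2 hα.2, hα.1, ?_, ⟨1, ?_⟩, ⟨0, ?_⟩,
      fun m hm hlt ↦ ?_, fun m hm hlt ↦ ?_⟩
    · simp [gapState, GapState.total]
    · simp [gapState]
    · simp [gapState]
    · simp only [gapState, Function.iterate_zero, id] at hlt; omega
    · simp only [gapState, Function.iterate_zero, id] at hlt; omega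
  | succ i ih => exact gapState_succ α i ▸ ih.next hirr

lemma total_gapState_strictAnti (hα : α ∈ Ioo (0 : ℝ) 1) (hirr : Irrational α) :
    StrictAnti fun i ↦ (gapState α i).total := by
  refine strictAnti_nat_of_succ_lt fun i ↦ ?_
  have h := gapState_valid hα hirr i
  rw [gapState_succ, GapState.total_next, GapState.total]
  exact max_lt (by linarith [h.leftGap_pos]) (by linarith [h.rightGap_pos])

lemma time_gapState_strictMono (hα : α ∈ Ioo (0 : ℝ) 1) (hirr : Irrational α) :
    StrictMono fun i ↦ (gapState α i).time := by
  refine strictMono_nat_of_lt_succ fun i ↦ ?_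
  have h := gapState_valid hα hirr i
  have hr := h.right_pos
  have hl := h.left_pos
  rw [gapState_succ, GapState.next]
  unfold GapState.time
  split_ifs <;> simp only <;> omega

lemma two_le_time_gapState (hα : α ∈ Ioo (0 : ℝ) 1) (hirr : Irrational α) (i : ℕ) :
    2 ≤ (gapState α i).time :=
  Nat.add_le_add (gapState_valid hα hirr i).right_pos (gapState_valid hα hirr i).left_pos

lemma right_left_gapState (α : ℝ) (i : ℕ) :
    ((gapState α i).right = 1 ∨ ∃ j < i, (gapState α i).right = (gapState α j).time) ∧
      ((gapState α i).left = 1 ∨ ∃ j < i, (gapState α i).left = (gapState α j).time) := by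
  induction i with
  | zero => simp [gapState]
  | succ i ih =>
    have lift {n : ℕ} (h : n = 1 ∨ ∃ j < i, n = (gapState α j).time) :
        n = 1 ∨ ∃ j < i + 1, n = (gapState α j).time :=
      h.imp_right fun ⟨j, hj, e⟩ ↦ ⟨j, by omega, e⟩
    rw [gapState_succ, GapState.next]
    split_ifs
    · exact ⟨.inr ⟨i, i.lt_succ_self, rfl⟩, lift ih.2⟩
    · exact ⟨lift ih.1, .inr ⟨i, i.lt_succ_self, rfl⟩⟩

/-- The return times occurring for the intervals `[0,β)` with `ρ ≤ β < 1`, apart from `1`. -/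
lemma length_mem_Rlight {ρ : ℝ} (hα : α ∈ Ioo (0 : ℝ) 1) (hirr : Irrational α) {N : ℕ}
    (hN : (gapState α N).total ≤ ρ) {w : List Bool} (hw : w ∈ Rlight α ρ) :
    w.length = 1 ∨ ∃ i < N, w.length = (gapState α i).time := by
  simp only [Rlight, Sitin, mem_iUnion, mem_ofPred_eq] at hw
  obtain ⟨β, ⟨hρβ, hβ1⟩, x, ⟨hx0, hxβ⟩, rfl⟩ := hw
  rw [length_itin]
  have hanti := total_gapState_strictAnti hα hirr
  have hex : ∃ i, (gapState α (i + 1)).total < β :=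
    ⟨N, (hanti N.lt_succ_self).trans_le (hN.trans hρβ)⟩
  classical
  obtain ⟨i, hi, hlt, hle⟩ :
      ∃ i ≤ N, (gapState α (i + 1)).total < β ∧ β ≤ (gapState α i).total := by
    refine ⟨Nat.find hex, Nat.find_min' hex ((hanti N.lt_succ_self).trans_le (hN.trans hρβ)),
      Nat.find_spec hex, ?_⟩
    rcases h : Nat.find hex with _ | j
    · simpa [gapState, GapState.total] using hβ1.le
    · exact not_lt.1 (Nat.find_min hex (m := j) (by omega))
  rw [gapState_succ, GapState.total_next, max_lt_iff] at hlt
  have hS := gapState_valid hα hirr i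
  have lift {n : ℕ} (h : n = 1 ∨ ∃ j < i, n = (gapState α j).time) :
      n = 1 ∨ ∃ j < N, n = (gapState α j).time :=
    h.imp_right fun ⟨j, hj, e⟩ ↦ ⟨j, by omega, e⟩
  rcases lt_or_ge (x + (gapState α i).rightGap) β with hr | hr
  · rw [hS.returnTime_right hα hirr hle hx0 hr]
    exact lift (right_left_gapState α i).1
  rcases le_or_gt (gapState α i).leftGap x with hl | hl
  · rw [hS.returnTime_left hα hirr hle hl hxβ]
    exact lift (right_left_gapState α i).2
  rw [hS.returnTime_middle hα hirr hle hlt.1 hlt.2 hr hl]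
  refine .inr ⟨i, lt_of_le_of_ne hi ?_, rfl⟩
  rintro rfl
  unfold GapState.total at hN
  linarith

lemma exists_mem_Rlight_of_lt_total {ρ : ℝ} (hα : α ∈ Ioo (0 : ℝ) 1) (hirr : Irrational α) {i : ℕ}
    (hi : ρ < (gapState α i).total) : ∃ w ∈ Rlight α ρ, w.length = (gapState α i).time := by
  have hS := gapState_valid hα hirr i
  have hlt := total_gapState_strictAnti hα hirr i.lt_succ_self
  obtain ⟨β, hβ, hβi⟩ := exists_between (max_lt hi hlt)
  simp only [gapState_succ, GapState.total_next, max_lt_iff] at hβ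
  refine ⟨itin α (Ico 0 β) (β - (gapState α i).rightGap), ?_, ?_⟩
  · simp only [Rlight, Sitin, mem_iUnion, mem_ofPred_eq]
    exact ⟨β, ⟨hβ.1.le, hβi.trans_le hS.total_le⟩, _,
      ⟨by linarith, by linarith [hS.rightGap_pos]⟩, rfl⟩
  · rw [length_itin]
    refine hS.returnTime_middle hα hirr hβi.le hβ.2.1 hβ.2.2 (by linarith) ?_
    unfold GapState.total at hβi
    linarith

lemma singleton_mem_Rlight {ρ : ℝ} (hα : α ∈ Ioo (0 : ℝ) 1) (hirr : Irrational α) (hρ : ρ < 1)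
    (b : Bool) : [b] ∈ Rlight α ρ := by
  have hS := gapState_valid hα hirr 0
  obtain ⟨β, hβ, hβ1⟩ := exists_between (max_lt hρ (max_lt hα.2 (by linarith [hα.1] : 1 - α < 1)))
  simp only [max_lt_iff] at hβ
  have htot : β ≤ (gapState α 0).total := by simpa [gapState, GapState.total] using hβ1.le
  simp only [Rlight, Sitin, mem_iUnion, mem_ofPred_eq]
  cases b
  · refine ⟨β, ⟨hβ.1.le, hβ1⟩, 0, ⟨le_rfl, by linarith [hα.1]⟩, ?_⟩
    rw [itin, hS.returnTime_right hα hirr htot le_rfl (by simpa [gapState] using hβ.2.2)]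
    simp [gapState, wordPrefix, seg, sturmian, not_le.2 hα.1]
  · refine ⟨β, ⟨hβ.1.le, hβ1⟩, α, ⟨hα.1.le, hβ.2.1⟩, ?_⟩
    rw [itin, hS.returnTime_left hα hirr htot (by simp [gapState]) hβ.2.1]
    simp [gapState, wordPrefix, seg, sturmian]

lemma length_injOn_Rlight {ρ : ℝ} (hα : α ∈ Ioo (0 : ℝ) 1) :
    InjOn List.length {w | w ∈ Rlight α ρ ∧ 2 ≤ w.length} := by
  rintro w ⟨hw, hw2⟩ w' ⟨hw', -⟩ h
  simp only [Rlight, Sitin, mem_iUnion, mem_ofPred_eq] at hw hw'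
  obtain ⟨β, hβ, x, hx, rfl⟩ := hw
  obtain ⟨β', hβ', x', hx', rfl⟩ := hw'
  simp only [length_itin] at h hw2
  exact itin_eq_of_returnTime_eq hα hβ.2.le hβ'.2.le hx hx' hw2 rfl h.symm

lemma ncard_Rlight_eq {ρ : ℝ} (hα : α ∈ Ioo (0 : ℝ) 1) (hirr : Irrational α) (hρ : ρ < 1) {N : ℕ}
    (hN : (gapState α N).total ≤ ρ) (hlt : ∀ i < N, ρ < (gapState α i).total) :
    (Rlight α ρ).ncard = 2 + N := by
  set W := {w | w ∈ Rlight α ρ ∧ 2 ≤ w.length} with hW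
  have himage : List.length '' W = (fun i ↦ (gapState α i).time) '' Iio N := by
    ext n
    constructor
    · rintro ⟨w, ⟨hw, hw2⟩, rfl⟩
      rcases length_mem_Rlight hα hirr hN hw with h | ⟨i, hi, h⟩
      · omega
      · exact ⟨i, hi, h.symm⟩
    · rintro ⟨i, hi, rfl⟩
      obtain ⟨w, hw, h⟩ := exists_mem_Rlight_of_lt_total hα hirr (hlt i hi)
      exact ⟨w, ⟨hw, h ▸ two_le_time_gapState hα hirr i⟩, h⟩
  have hinj := length_injOn_Rlight (ρ := ρ) hα
  have hWcard : W.ncard = N := by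
    rw [← hinj.ncard_image, himage,
      ncard_image_of_injective _ (time_gapState_strictMono hα hirr).injective]
    simp [Set.ncard_eq_toFinset_card']
  have hWfin : W.Finite := Finite.of_finite_image (himage ▸ (finite_Iio N).image _) hinj
  have hunion : Rlight α ρ = {[false], [true]} ∪ W := by
    ext w
    simp only [mem_union, mem_insert_iff, mem_singleton_iff]
    constructor
    · intro hw
      rcases length_mem_Rlight hα hirr hN hw with h | ⟨i, -, h⟩
      · obtain ⟨b, rfl⟩ := List.length_eq_one_iff.1 h
        cases b <;> simp
      · exact .inr ⟨hw, h ▸ two_le_time_gapState hα hirr i⟩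
    · rintro ((rfl | rfl) | hw)
      · exact singleton_mem_Rlight hα hirr hρ _
      · exact singleton_mem_Rlight hα hirr hρ _
      · exact hw.1
  have hdisj : Disjoint ({[false], [true]} : Set (List Bool)) W := by
    rw [Set.disjoint_left]
    rintro w (rfl | rfl) ⟨-, h⟩ <;> simp at h
  rw [hunion, ncard_union_eq hdisj (toFinite _) hWfin, hWcard, ncard_pair (by simp)]

end GapState

/-! ### Comparison with the continued fraction expansion -/

/-- The error `|p_{k-1} - α q_{k-1}|`, as a product of iterates of the Gauss map. -/
noncomputable def cfErr (α : ℝ) (k : ℕ) : ℝ := ∏ i ∈ Finset.range k, gaussMap^[i] α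

section ContinuedFraction

variable {α : ℝ}

lemma gaussMap_iterate_mem (hα : α ∈ Ioo (0 : ℝ) 1) (hirr : Irrational α) (k : ℕ) :
    gaussMap^[k] α ∈ Ioo (0 : ℝ) 1 ∧ Irrational (gaussMap^[k] α) := by
  induction k with
  | zero => exact ⟨hα, hirr⟩
  | succ k ih =>
    rw [Function.iterate_succ_apply', gaussMap]
    have h : Irrational (Int.fract (gaussMap^[k] α)⁻¹) := by
      rw [Int.fract]
      exact ih.2.inv.sub_intCast _
    exact ⟨⟨lt_of_le_of_ne (Int.fract_nonneg _) h.ne_zero.symm, Int.fract_lt_one _⟩, h⟩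

lemma cfErr_pos (hα : α ∈ Ioo (0 : ℝ) 1) (hirr : Irrational α) (k : ℕ) : 0 < cfErr α k :=
  Finset.prod_pos fun i _ ↦ (gaussMap_iterate_mem hα hirr i).1.1

lemma cfErr_succ (α : ℝ) (k : ℕ) : cfErr α (k + 1) = cfErr α k * gaussMap^[k] α :=
  Finset.prod_range_succ _ _

lemma cfErr_succ_lt (hα : α ∈ Ioo (0 : ℝ) 1) (hirr : Irrational α) (k : ℕ) :
    cfErr α (k + 1) < cfErr α k := by
  rw [cfErr_succ]
  exact mul_lt_of_lt_one_right (cfErr_pos hα hirr k) (gaussMap_iterate_mem hα hirr k).1.2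

lemma cfErr_add_two (hα : α ∈ Ioo (0 : ℝ) 1) (hirr : Irrational α) (k : ℕ) :
    cfErr α (k + 2) = cfErr α k - cfa α (k + 1) * cfErr α (k + 1) := by
  have hg := (gaussMap_iterate_mem hα hirr k).1.1
  have hfloor : ((cfa α (k + 1) : ℕ) : ℝ) = (⌊(gaussMap^[k] α)⁻¹⌋ : ℝ) := by
    rw [cfa, Nat.add_sub_cancel]
    exact natCast_floor_eq_intCast_floor (inv_nonneg.2 hg.le)
  have hcancel : cfErr α (k + 1) * (gaussMap^[k] α)⁻¹ = cfErr α k := by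
    rw [cfErr_succ, mul_inv_cancel_right₀ hg.ne']
  rw [cfErr_succ α (k + 1), Function.iterate_succ_apply', gaussMap, Int.fract, ← hfloor, mul_sub,
    hcancel, mul_comm (cfErr α (k + 1))]

lemma one_le_cfa (hα : α ∈ Ioo (0 : ℝ) 1) (hirr : Irrational α) (k : ℕ) : 1 ≤ cfa α (k + 1) := by
  have hg := (gaussMap_iterate_mem hα hirr k).1
  rw [cfa, Nat.add_sub_cancel, Nat.one_le_floor_iff]
  exact (one_le_inv₀ hg.1).2 hg.2.le

lemma cfPQ_sub (hα : α ∈ Ioo (0 : ℝ) 1) (hirr : Irrational α) (k : ℕ) :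
    ((cfPQ α k).1 : ℝ) - α * (cfPQ α k).2 = (-1) ^ k * cfErr α k := by
  induction k using Nat.twoStepInduction with
  | zero => simp [cfPQ, cfErr]
  | one => simp [cfPQ, cfErr]
  | more k ih ih' =>
    rw [cfErr_add_two hα hirr, cfPQ]
    push_cast
    linear_combination ih + (cfa α (k + 1) : ℝ) * ih'

lemma cfDelta_eq (hα : α ∈ Ioo (0 : ℝ) 1) (hirr : Irrational α) {k s : ℕ}
    (hs : s ≤ cfa α (k + 1)) :
    cfDelta α k s = cfErr α k - (s - 1) * cfErr α (k + 1) := by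
  have h2 := cfErr_add_two hα hirr k
  have hpos := cfErr_pos hα hirr (k + 1)
  have hpos' := cfErr_pos hα hirr (k + 2)
  have hs' : (s : ℝ) * cfErr α (k + 1) ≤ cfa α (k + 1) * cfErr α (k + 1) := by gcongr
  rw [cfDelta, cfPQ_sub hα hirr, cfPQ_sub hα hirr]
  have : ((s : ℝ) - 1) * ((-1) ^ (k + 1) * cfErr α (k + 1)) + (-1) ^ k * cfErr α k =
      (-1) ^ k * (cfErr α k - (s - 1) * cfErr α (k + 1)) := by ring
  rw [this, abs_mul, abs_pow, abs_neg, abs_one, one_pow, one_mul, abs_of_pos (by linarith)]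

/-- Subtracting the smaller gap from the larger one, as an identity of unordered pairs. -/
lemma GapState.next_gaps {S : GapState} {a b : ℝ} (hab : a < b)
    (h : s(S.rightGap, S.leftGap) = s(a, b)) :
    s(S.next.rightGap, S.next.leftGap) = s(a, b - a) := by
  rw [Sym2.eq_iff] at h
  rcases h with ⟨h1, h2⟩ | ⟨h1, h2⟩
  · rw [GapState.next_of_not_lt (by linarith), h1, h2]
  · rw [GapState.next_of_lt (by linarith), h1, h2, Sym2.eq_swap]

lemma gaps_gapState_add (hα : α ∈ Ioo (0 : ℝ) 1) (hirr : Irrational α) {k n : ℕ}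
    (h : s((gapState α n).rightGap, (gapState α n).leftGap) =
      s(cfErr α (k + 1), cfErr α k - cfErr α (k + 1))) {j : ℕ} (hj : j < cfa α (k + 1)) :
    s((gapState α (n + j)).rightGap, (gapState α (n + j)).leftGap) =
      s(cfErr α (k + 1), cfErr α k - (j + 1) * cfErr α (k + 1)) := by
  induction j with
  | zero => simpa using h
  | succ j ih =>
    have h2 := cfErr_add_two hα hirr k
    have hpos := cfErr_pos hα hirr (k + 1)
    have hpos' := cfErr_pos hα hirr (k + 2)
    have hcast : ((j : ℝ) + 1 + 1) ≤ cfa α (k + 1) := by exact_mod_cast hj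
    have hle := mul_le_mul_of_nonneg_right hcast hpos.le
    rw [← add_assoc, gapState_succ, GapState.next_gaps (by linarith) (ih (by omega))]
    push_cast
    rw [sub_sub, ← add_one_mul]

lemma gaps_gapState_sum (hα : α ∈ Ioo (0 : ℝ) 1) (hirr : Irrational α) (k : ℕ) :
    s((gapState α (∑ i ∈ Finset.range k, cfa α (i + 1))).rightGap,
        (gapState α (∑ i ∈ Finset.range k, cfa α (i + 1))).leftGap) =
      s(cfErr α (k + 1), cfErr α k - cfErr α (k + 1)) := by
  induction k with
  | zero => simp [gapState, cfErr, Sym2.eq_swap]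
  | succ k ih =>
    obtain ⟨a, ha⟩ : ∃ a, cfa α (k + 1) = a + 1 :=
      ⟨_, (Nat.sub_add_cancel (one_le_cfa hα hirr k)).symm⟩
    have h2 := cfErr_add_two hα hirr k
    rw [ha] at h2
    push_cast at h2
    have hlast := gaps_gapState_add hα hirr ih (j := a) (by omega)
    rw [← h2, Sym2.eq_swap (a := cfErr α (k + 1))] at hlast
    rw [Finset.sum_range_succ, ha, ← add_assoc, gapState_succ,
      GapState.next_gaps (cfErr_succ_lt hα hirr (k + 1)) hlast]

lemma total_gapState_eq_cfDelta (hα : α ∈ Ioo (0 : ℝ) 1) (hirr : Irrational α) {k j : ℕ}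
    (hj : j + 1 ≤ cfa α (k + 1)) :
    (gapState α (∑ i ∈ Finset.range k, cfa α (i + 1) + j)).total = cfDelta α k (j + 1) := by
  have h := gaps_gapState_add hα hirr (gaps_gapState_sum hα hirr k) hj
  rw [cfDelta_eq hα hirr hj, GapState.total]
  push_cast
  rw [Sym2.eq_iff] at h
  rcases h with ⟨h1, h2⟩ | ⟨h1, h2⟩ <;> rw [h1, h2] <;> ring

end ContinuedFraction

/-- if `(k,s)` is the lexicographically minimal pair with
`1 ≤ s ≤ a_{k+1}` and `ρ ≥ δ_{k,s}`, then `#R^α_ρ = 1 + a_1 + ⋯ + a_k + s`. -/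
theorem card_Rlight (α ρ : ℝ) (hα : α ∈ Set.Ioo (0:ℝ) 1) (hirr : Irrational α)
    (hρ : ρ ∈ Set.Ioo (0:ℝ) 1) (k s : ℕ) (hs1 : 1 ≤ s) (hs2 : s ≤ cfa α (k + 1))
    (hρδ : cfDelta α k s ≤ ρ)
    (hmin : ∀ k' s' : ℕ, 1 ≤ s' → s' ≤ cfa α (k' + 1) → cfDelta α k' s' ≤ ρ →
      k < k' ∨ (k = k' ∧ s ≤ s')) :
    (Rlight α ρ).ncard = 1 + (∑ i ∈ Finset.range k, cfa α (i + 1)) + s := by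
  obtain ⟨j, rfl⟩ : ∃ j, s = j + 1 := ⟨s - 1, by omega⟩
  have hanti := (total_gapState_strictAnti hα hirr).antitone
  rw [ncard_Rlight_eq hα hirr hρ.2 (N := ∑ i ∈ Finset.range k, cfa α (i + 1) + j)]
  · omega
  · rwa [total_gapState_eq_cfDelta hα hirr hs2]
  intro i hi
  rcases j with _ | j
  · rcases k with _ | k
    · simp at hi
    obtain ⟨a, ha⟩ : ∃ a, cfa α (k + 1) = a + 1 :=
      ⟨_, (Nat.sub_add_cancel (one_le_cfa hα hirr k)).symm⟩
    rw [Finset.sum_range_succ, ha] at hi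
    refine lt_of_lt_of_le ?_ (hanti (show i ≤ ∑ i ∈ Finset.range k, cfa α (i + 1) + a by omega))
    simp only [total_gapState_eq_cfDelta hα hirr ha.ge]
    by_contra! hle
    have := hmin k (a + 1) (by omega) ha.ge hle
    omega
  · refine lt_of_lt_of_le ?_ (hanti (show i ≤ ∑ i ∈ Finset.range k, cfa α (i + 1) + j by omega))
    simp only [total_gapState_eq_cfDelta hα hirr (show j + 1 ≤ cfa α (k + 1) by omega)]
    by_contra! hle
    have := hmin k (j + 1) (by omega) (by omega) hle
    omega
end

section
/- Let α ∈ (0,1) be irrational. Then the set R^α_0 = ⋃_{0 < β < 1} S_β of all [0,β)-itineraries over all β ∈ (0,1) is infinite; consequently, the set APR_{u_{α,0}} of abelian return words to prefixes of the Sturmian word with slope α and intercept ρ = 0 is infinite. -/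
open Set

theorem twoIE_iterate_zero {α : ℝ} (hα : α ∈ Ioo (0 : ℝ) 1) (n : ℕ) :
    (twoIE α)^[n] 0 = Int.fract (-(n * α)) := by
  induction n with
  | zero => simp
  | succ n ih =>
    rw [Function.iterate_succ_apply', ih, eq_comm, Int.fract_eq_iff]
    have h0 := Int.fract_nonneg (-(n * α))
    have h1 := Int.fract_lt_one (-(n * α))
    have hf := Int.self_sub_fract (-(n * α))
    obtain ⟨hα0, hα1⟩ := hα
    unfold twoIE
    split_ifs with h
    · refine ⟨by linarith, by linarith, ⌊-(n * α)⌋ - 1, ?_⟩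
      push_cast
      linarith
    · refine ⟨by linarith, by linarith, ⌊-(n * α)⌋, ?_⟩
      push_cast
      linarith

theorem seg_succ (u : ℕ → Bool) (i n : ℕ) : seg u i (n + 1) = seg u i n ++ [u (i + n)] := by
  simp [seg, List.range_succ]

@[simp]
theorem length_seg (u : ℕ → Bool) (i n : ℕ) : (seg u i n).length = n := by
  simp [seg]

theorem count_false_seg_sturmian (α ρ : ℝ) (i n : ℕ) :
    ((seg (sturmian α ρ) i n).count false : ℝ) =
      (twoIE α)^[i + n] ρ - (twoIE α)^[i] ρ + n * α := by
  induction n with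
  | zero => simp [seg]
  | succ n ih =>
    rw [seg_succ, List.count_append, Nat.cast_add, ih, ← add_assoc,
      Function.iterate_succ_apply']
    by_cases h : α ≤ (twoIE α)^[i + n] ρ
    · simp [sturmian, twoIE, h, not_lt.2 h]
      ring
    · simp [sturmian, twoIE, h, not_le.1 h]
      ring

theorem exists_fract_nat_mul_mem_Ioo {θ : ℝ} (hθ : Irrational θ) {ε : ℝ} (hε : 0 < ε) :
    ∃ n : ℕ, 1 ≤ n ∧ Int.fract (n * θ) ∈ Ioo 0 ε := by
  wlog hε1 : ε ≤ 1 generalizing ε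
  · obtain ⟨n, hn, h0, h1⟩ := this one_pos le_rfl
    exact ⟨n, hn, h0, h1.trans (not_le.1 hε1)⟩
  have hdense : DenseRange (· • (θ : AddCircle (1 : ℝ)) : ℤ → AddCircle (1 : ℝ)) :=
    AddCircle.denseRange_zsmul_coe_iff.2 (by simpa using hθ)
  have hcl : MapClusterPt ((ε / 2 : ℝ) : AddCircle (1 : ℝ)) Filter.atTop
      (fun n : ℕ => n • (θ : AddCircle (1 : ℝ))) :=
    ((mapClusterPt_atTop_nsmul_tfae _ _).out 0 3).2 (hdense _)
  have hopen : IsOpen ((fun x : ℝ => (x : AddCircle (1 : ℝ))) '' Ioo 0 ε) :=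
    QuotientAddGroup.isOpenMap_coe _ isOpen_Ioo
  have hfreq := hcl.frequently
    (hopen.mem_nhds ⟨ε / 2, ⟨by linarith, by linarith⟩, rfl⟩)
  obtain ⟨n, ⟨t, ht, hnt⟩, hn⟩ := (hfreq.and_eventually (Filter.eventually_ge_atTop 1)).exists
  refine ⟨n, hn, ?_⟩
  have hcoe : (t : AddCircle (1 : ℝ)) = ((n * θ : ℝ) : AddCircle (1 : ℝ)) := by
    simpa [nsmul_eq_mul] using hnt
  obtain ⟨z, hz⟩ := AddSubgroup.mem_zmultiples_iff.1 (QuotientAddGroup.eq.1 hcoe)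
  have hfract : Int.fract (n * θ) = t := by
    rw [Int.fract_eq_iff]
    refine ⟨ht.1.le, ht.2.trans_le hε1, z, ?_⟩
    simp only [zsmul_eq_mul, mul_one] at hz
    linarith
  rwa [hfract]

/-- The orbit of `0` avoids a neighbourhood of `0` up to any prescribed positive time. -/
theorem exists_lt_twoIE_iterate_zero {α : ℝ} (hα : α ∈ Ioo (0 : ℝ) 1) (hirr : Irrational α)
    (N : ℕ) :
    ∃ ε ∈ Ioo (0 : ℝ) 1, ∀ m, 0 < m → m ≤ N → ε ≤ (twoIE α)^[m] 0 := by
  induction N with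
  | zero => exact ⟨1 / 2, by norm_num, fun m h h' => by omega⟩
  | succ N ih =>
    obtain ⟨ε, ⟨h0, h1⟩, h⟩ := ih
    have hpos : 0 < (twoIE α)^[N + 1] 0 := by
      rw [twoIE_iterate_zero hα, Int.fract_pos]
      have := (hirr.natCast_mul (Nat.succ_ne_zero N)).neg
      exact this.ne_int _
    refine ⟨min ε ((twoIE α)^[N + 1] 0), ⟨lt_min h0 hpos, (min_le_left _ _).trans_lt h1⟩,
      fun m hm hmN => ?_⟩
    rcases hmN.lt_or_eq with hlt | rfl
    · exact (min_le_left _ _).trans (h m hm (by omega))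
    · exact min_le_right _ _

/-- The orbit of `0` returns to every interval `[0, ε)`. -/
theorem exists_twoIE_iterate_zero_lt {α : ℝ} (hα : α ∈ Ioo (0 : ℝ) 1) (hirr : Irrational α)
    {ε : ℝ} (hε : 0 < ε) :
    ∃ m, 0 < m ∧ (twoIE α)^[m] 0 ∈ Ico 0 ε := by
  obtain ⟨m, hm, h⟩ := exists_fract_nat_mul_mem_Ioo hirr.neg hε
  refine ⟨m, hm, ?_⟩
  rw [twoIE_iterate_zero hα, ← mul_neg]
  exact ⟨h.1.le, h.2⟩

/-- The factor of length `n` at position `i` is abelian equivalent to the prefix of length `n`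
iff the `i`-th point of the orbit of `0` lies in `[0, {nα})`. -/
theorem mem_abOcc_wordPrefix_iff {α : ℝ} (hα : α ∈ Ioo (0 : ℝ) 1) {n i : ℕ}
    (hn : 0 < Int.fract (n * α)) :
    i ∈ abOcc (sturmian α 0) (wordPrefix (sturmian α 0) n) ↔
      (twoIE α)^[i] 0 < Int.fract (n * α) := by
  have hi := count_false_seg_sturmian α 0 i n
  have h0 := count_false_seg_sturmian α 0 0 n
  have hin : (twoIE α)^[i + n] 0 = Int.fract ((twoIE α)^[i] 0 - n * α) := by
    rw [twoIE_iterate_zero hα, twoIE_iterate_zero hα, eq_comm, Int.fract_eq_fract]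
    refine ⟨-⌊-(i * α)⌋, ?_⟩
    have := Int.self_sub_fract (-(i * α))
    push_cast
    linarith
  have hnn : (twoIE α)^[0 + n] 0 = 1 - Int.fract (n * α) := by
    rw [zero_add, twoIE_iterate_zero hα, Int.fract_neg hn.ne']
  rw [hnn] at h0
  simp only [Function.iterate_zero, id] at h0
  have hx0 : 0 ≤ (twoIE α)^[i] 0 := by
    rw [twoIE_iterate_zero hα]; exact Int.fract_nonneg _
  have hx1 : (twoIE α)^[i] 0 < 1 := by
    rw [twoIE_iterate_zero hα]; exact Int.fract_lt_one _
  have hc1 := Int.fract_lt_one (n * α)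
  have hfl := Int.self_sub_fract (n * α)
  have hocc : i ∈ abOcc (sturmian α 0) (wordPrefix (sturmian α 0) n) ↔
      (seg (sturmian α 0) i n).count false = (seg (sturmian α 0) 0 n).count false := by
    simp [abOcc, AbEquiv, wordPrefix]
  rw [hocc, ← Nat.cast_inj (R := ℝ), hi, h0, hin]
  constructor
  · intro h
    linarith [Int.fract_lt_one ((twoIE α)^[i] 0 - n * α)]
  · intro h
    have : Int.fract ((twoIE α)^[i] 0 - n * α) =
        (twoIE α)^[i] 0 + 1 - Int.fract (n * α) := by
      rw [Int.fract_eq_iff]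
      refine ⟨by linarith, by linarith, -⌊n * α⌋ - 1, ?_⟩
      push_cast
      linarith
    rw [this]
    ring

theorem infinite_of_forall_exists_lt_length {β : Type*} {s : Set (List β)}
    (h : ∀ N : ℕ, ∃ w ∈ s, N < w.length) : s.Infinite := by
  refine Set.Infinite.of_image List.length (Set.infinite_of_forall_exists_gt fun N => ?_)
  obtain ⟨w, hw, hN⟩ := h N
  exact ⟨w.length, mem_image_of_mem _ hw, hN⟩

/-- `R^α_0 = ⋃_{0<β<1} S_β` is infinite, and consequently
`APR_{u_{α,0}}` is infinite. -/
theorem Rlight_zero_infinite (α : ℝ) (hα : α ∈ Set.Ioo (0:ℝ) 1)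
    (hirr : Irrational α) :
    (⋃ β ∈ Set.Ioo (0:ℝ) 1, Sitin α β).Infinite ∧
      (APR (sturmian α 0)).Infinite := by
  refine ⟨infinite_of_forall_exists_lt_length fun N => ?_,
    infinite_of_forall_exists_lt_length fun N => ?_⟩
  · obtain ⟨ε, hε, hN⟩ := exists_lt_twoIE_iterate_zero hα hirr N
    refine ⟨itin α (Ico 0 ε) 0, mem_biUnion hε ⟨0, ⟨le_rfl, hε.1⟩, rfl⟩, ?_⟩
    have hmem : 0 < returnTime α (Ico 0 ε) 0 ∧
        (twoIE α)^[returnTime α (Ico 0 ε) 0] 0 ∈ Ico 0 ε :=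
      Nat.sInf_mem (exists_twoIE_iterate_zero_lt hα hirr hε.1)
    rw [itin, wordPrefix, length_seg]
    by_contra! hle
    exact (hN _ hmem.1 hle).not_gt hmem.2.2
  · obtain ⟨ε, hε, hN⟩ := exists_lt_twoIE_iterate_zero hα hirr N
    obtain ⟨n, hn, hpos, hlt⟩ := exists_fract_nat_mul_mem_Ioo hirr hε.1
    have hocc (i : ℕ) := mem_abOcc_wordPrefix_iff hα (i := i) hpos
    have hex : ∃ j, 0 < j ∧ j ∈ abOcc (sturmian α 0) (wordPrefix (sturmian α 0) n) := by
      obtain ⟨m, hm, h⟩ := exists_twoIE_iterate_zero_lt hα hirr hpos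
      exact ⟨m, hm, (hocc m).2 h.2⟩
    classical
    obtain ⟨hj0, hj⟩ := Nat.find_spec hex
    refine ⟨seg (sturmian α 0) 0 (Nat.find hex - 0), mem_biUnion hn
      ⟨0, Nat.find hex, (hocc 0).2 (by simpa using hpos), hj, hj0,
        fun m hm hlt hmem => Nat.find_min hex hlt ⟨hm, hmem⟩, rfl⟩, ?_⟩
    rw [length_seg, Nat.sub_zero]
    by_contra! hle
    exact (hN _ hj0 hle).not_gt (((hocc _).1 hj).trans hlt)
end

section
/- Let α, ρ ∈ (0,1) with α irrational. If max{α, 1−α} ≤ ρ < 1, then R^α_ρ = {0, 1, 01}, where 0, 1, 01 denote the binary words of lengths 1, 1, 2 respectively. -/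
open Set

theorem returnTime_eq_one {α x : ℝ} {I : Set ℝ} (h : twoIE α x ∈ I) :
    returnTime α I x = 1 :=
  IsLeast.csInf_eq ⟨⟨one_pos, h⟩, fun _ hm => hm.1⟩

theorem returnTime_eq_two {α x : ℝ} {I : Set ℝ} (h₁ : twoIE α x ∉ I)
    (h₂ : twoIE α (twoIE α x) ∈ I) : returnTime α I x = 2 := by
  refine IsLeast.csInf_eq ⟨⟨two_pos, h₂⟩, fun m hm => ?_⟩
  have hm₁ : m ≠ 1 := by
    rintro rfl
    exact h₁ hm.2
  have := hm.1
  omega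

theorem itin_of_return_one {α x : ℝ} {I : Set ℝ} (h : twoIE α x ∈ I) :
    itin α I x = [decide (α ≤ x)] := by
  simp [itin, returnTime_eq_one h, wordPrefix, seg, sturmian]
  congr

theorem itin_of_return_two {α x : ℝ} {I : Set ℝ} (h₁ : twoIE α x ∉ I)
    (h₂ : twoIE α (twoIE α x) ∈ I) :
    itin α I x = [decide (α ≤ x), decide (α ≤ twoIE α x)] := by
  simp [itin, returnTime_eq_two h₁ h₂, wordPrefix, seg, sturmian, List.range_succ]
  congr

theorem itin_Ico_eq_one {α β x : ℝ} (hβ : β < 1) (h : 1 - α ≤ β) (hx : α ≤ x) (hxβ : x < β) :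
    itin α (Ico 0 β) x = [true] := by
  have hT : twoIE α x = x - α := if_neg hx.not_gt
  rw [itin_of_return_one (hT ▸ ⟨by linarith, by linarith⟩), decide_eq_true hx]

theorem itin_Ico_eq_zero {α β x : ℝ} (hα : α < 1) (hx : 0 ≤ x) (hxα : x < α)
    (hxβ : x + 1 - α < β) : itin α (Ico 0 β) x = [false] := by
  have hT : twoIE α x = x + 1 - α := if_pos hxα
  rw [itin_of_return_one (hT ▸ ⟨by linarith, hxβ⟩), decide_eq_false hxα.not_ge]

theorem itin_Ico_eq_zero_one {α β x : ℝ} (hα : α ≤ β) (hα' : 1 - α ≤ β) (hxα : x < α)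
    (hxβ : β ≤ x + 1 - α) : itin α (Ico 0 β) x = [false, true] := by
  have hT : twoIE α x = x + 1 - α := if_pos hxα
  have hα₁ : α ≤ twoIE α x := by linarith
  have hTT : twoIE α (twoIE α x) = x + 1 - α - α := by
    rw [← hT]
    exact if_neg hα₁.not_gt
  rw [itin_of_return_two (hT ▸ fun h => hxβ.not_gt h.2)
    (hTT ▸ ⟨by linarith, by linarith⟩), decide_eq_false hxα.not_ge, decide_eq_true hα₁]

/-- if `max{α,1-α} ≤ ρ < 1` then `R^α_ρ = {0, 1, 01}`. -/
theorem Rlight_eq_of_large_intercept (α ρ : ℝ) (hα : α ∈ Set.Ioo (0:ℝ) 1)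
    (hirr : Irrational α) (hρ : ρ ∈ Set.Ioo (0:ℝ) 1)
    (h : max α (1 - α) ≤ ρ) :
    Rlight α ρ = ({[false], [true], [false, true]} : Set (List Bool)) := by
  obtain ⟨hα₀, hα₁⟩ := hα
  obtain ⟨hαρ, hαρ'⟩ := max_le_iff.mp h
  have hρ₁ := hρ.2
  ext w
  simp only [Rlight, Sitin, mem_iUnion, mem_ofPred_eq, mem_insert_iff, mem_singleton_iff]
  constructor
  · rintro ⟨β, ⟨hρβ, hβ⟩, x, ⟨hx, hxβ⟩, rfl⟩
    rcases le_or_gt α x with hαx | hxα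
    · exact .inr (.inl (itin_Ico_eq_one hβ (by linarith) hαx hxβ))
    · rcases lt_or_ge (x + 1 - α) β with h₁ | h₁
      · exact .inl (itin_Ico_eq_zero hα₁ hx hxα h₁)
      · exact .inr (.inr (itin_Ico_eq_zero_one (by linarith) (by linarith) hxα h₁))
  · have hβ : (ρ + 1) / 2 ∈ Ico ρ 1 := ⟨by linarith, by linarith⟩
    rintro (rfl | rfl | rfl)
    · exact ⟨_, hβ, 0, ⟨le_rfl, by linarith⟩,
        itin_Ico_eq_zero hα₁ le_rfl hα₀ (by linarith)⟩
    · exact ⟨_, hβ, α, ⟨hα₀.le, by linarith⟩,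
        itin_Ico_eq_one hβ.2 (by linarith) le_rfl (by linarith)⟩
    · exact ⟨_, hβ, (ρ + 1) / 2 + α - 1, ⟨by linarith, by linarith⟩,
        itin_Ico_eq_zero_one (by linarith) (by linarith) (by linarith) (by linarith)⟩
end
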